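/- arXiv:2502.11701 — 2 statements merged into one kernel-verified Lean document; each statement's English description precedes it below -/
import Mathlib

section
/- Let μ ∈ ℝ^n be nonzero and let Σ ∈ ℝ^{n×n} be symmetric positive definite, and suppose 𝟏ᵀ Σ⁻¹ μ > 0, where 𝟏 ∈ ℝ^n is the all-ones vector. Then the portfolio ŵ = Σ⁻¹ μ / (𝟏ᵀ Σ⁻¹ μ) satisfies 𝟏ᵀ ŵ = 1 and maximizes the Sharpe ratio over the set {w ∈ ℝ^n : 𝟏ᵀ w = 1}; that is, SR(w | μ, Σ) ≤ SR(ŵ | μ, Σ) for every w with 𝟏ᵀ w = 1. -/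
open Matrix

/-- The Cauchy–Schwarz inequality for the bilinear form of a real positive semidefinite matrix. -/
lemma Matrix.PosSemidef.dotProduct_mulVec_sq_le {n : Type*} [Fintype n] {S : Matrix n n ℝ}
    (hS : S.PosSemidef) (x y : n → ℝ) :
    (x ⬝ᵥ (S *ᵥ y)) ^ 2 ≤ (x ⬝ᵥ (S *ᵥ x)) * (y ⬝ᵥ (S *ᵥ y)) := by
  have hsymm : y ⬝ᵥ (S *ᵥ x) = x ⬝ᵥ (S *ᵥ y) := by
    have hT : Sᵀ = S := by simpa [IsHermitian] using hS.isHermitian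
    rw [dotProduct_comm, dotProduct_mulVec, ← mulVec_transpose, hT]
  have hquad (t : ℝ) :
      0 ≤ (x ⬝ᵥ (S *ᵥ x)) * (t * t) + 2 * (x ⬝ᵥ (S *ᵥ y)) * t + y ⬝ᵥ (S *ᵥ y) := by
    have h := hS.dotProduct_mulVec_nonneg (t • x + y)
    simp only [star_trivial, mulVec_add, mulVec_smul, dotProduct_add, add_dotProduct,
      smul_dotProduct, dotProduct_smul, smul_eq_mul, hsymm] at h
    linarith
  have h := discrim_le_zero hquad
  rw [discrim] at h
  linarith

/-- For nonzero `μ`, symmetric positive definite `S`, and `𝟏ᵀ S⁻¹ μ > 0`,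
the portfolio `ŵ = S⁻¹ μ / (𝟏ᵀ S⁻¹ μ)` satisfies the budget constraint `𝟏ᵀ ŵ = 1` and
maximizes the Sharpe ratio over `{w : 𝟏ᵀ w = 1}`. -/
theorem tangent_portfolio_maximizes_sharpe {n : ℕ} (μ : Fin n → ℝ) (hμ : μ ≠ 0)
    (S : Matrix (Fin n) (Fin n) ℝ) (hS : S.PosDef)
    (hpos : 0 < (1 : Fin n → ℝ) ⬝ᵥ (S⁻¹ *ᵥ μ)) :
    (1 : Fin n → ℝ) ⬝ᵥ (((1 : Fin n → ℝ) ⬝ᵥ (S⁻¹ *ᵥ μ))⁻¹ • (S⁻¹ *ᵥ μ)) = 1 ∧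
      ∀ w : Fin n → ℝ, (1 : Fin n → ℝ) ⬝ᵥ w = 1 →
        μ ⬝ᵥ w / Real.sqrt (w ⬝ᵥ (S *ᵥ w))
          ≤ μ ⬝ᵥ (((1 : Fin n → ℝ) ⬝ᵥ (S⁻¹ *ᵥ μ))⁻¹ • (S⁻¹ *ᵥ μ))
              / Real.sqrt ((((1 : Fin n → ℝ) ⬝ᵥ (S⁻¹ *ᵥ μ))⁻¹ • (S⁻¹ *ᵥ μ)) ⬝ᵥ
                  (S *ᵥ (((1 : Fin n → ℝ) ⬝ᵥ (S⁻¹ *ᵥ μ))⁻¹ • (S⁻¹ *ᵥ μ)))) := by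
  refine ⟨by rw [dotProduct_smul, smul_eq_mul, inv_mul_cancel₀ hpos.ne'], fun w hw => ?_⟩
  have hSv : S *ᵥ (S⁻¹ *ᵥ μ) = μ := by
    rw [mulVec_mulVec, mul_nonsing_inv _ ((isUnit_iff_isUnit_det S).1 hS.isUnit), one_mulVec]
  set v := S⁻¹ *ᵥ μ
  set c := (1 : Fin n → ℝ) ⬝ᵥ v
  have hw0 : w ≠ 0 := by
    rintro rfl
    simp at hw
  have hwS : 0 < w ⬝ᵥ (S *ᵥ w) := hS.dotProduct_mulVec_pos hw0
  have hCS := hS.posSemidef.dotProduct_mulVec_sq_le w v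
  have hvS := hS.posSemidef.dotProduct_mulVec_nonneg v
  rw [star_trivial] at hvS
  simp only [hSv, dotProduct_comm _ μ] at hCS hvS
  have hsharpe : μ ⬝ᵥ (c⁻¹ • v) / √((c⁻¹ • v) ⬝ᵥ (S *ᵥ (c⁻¹ • v))) = √(μ ⬝ᵥ v) := by
    rw [mulVec_smul, hSv, smul_dotProduct, dotProduct_smul, dotProduct_smul, dotProduct_comm v μ]
    simp only [smul_eq_mul]
    rw [← mul_assoc, Real.sqrt_mul (by positivity), Real.sqrt_mul_self (by positivity),
      mul_div_mul_left _ _ (by positivity), Real.div_sqrt]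
  rw [hsharpe, div_le_iff₀ (Real.sqrt_pos.2 hwS), ← Real.sqrt_mul hvS, mul_comm]
  exact Real.le_sqrt_of_sq_le hCS
end

section
/- Let Σ ∈ ℝ^{n×n} be symmetric positive definite, let L ∈ ℝ^{n×n} be any invertible matrix with Σ = L Lᵀ, let ŵ ∈ ℝ^n be nonzero, and let k ∈ {1, …, n}. Let 𝒦 be the family of all subsets of {1, …, n} of cardinality k, and for K ∈ 𝒦 let P_K = {w ∈ ℝ^n : (Lᵀ w)_i = 0 for all i ∉ K}. Let K* ∈ 𝒦 be a set of k indices corresponding to k largest values of |(Lᵀ ŵ)_i|. Then K* minimizes over K ∈ 𝒦 the quantity inf over nonzero w ∈ P_K of arccos( ⟨Lᵀ w, Lᵀ ŵ⟩ / (‖Lᵀ w‖₂ ‖Lᵀ ŵ‖₂) ); that is, for every K ∈ 𝒦, the infimum over nonzero w ∈ P_{K*} of this angle is less than or equal to the infimum over nonzero w ∈ P_K. -/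
open Matrix

/-- A set of indices carrying the largest values of `f` has the largest sum of values of `f`
among all sets of the same cardinality. -/
theorem sum_le_sum_of_card_eq_of_top {ι : Type*} [DecidableEq ι] {f : ι → ℝ} {s t : Finset ι}
    (hst : t.card = s.card) (htop : ∀ i ∈ s, ∀ j ∉ s, f j ≤ f i) :
    ∑ i ∈ t, f i ≤ ∑ i ∈ s, f i := by
  rcases s.eq_empty_or_nonempty with rfl | hs
  · simp_all
  obtain ⟨m, hm, hmin⟩ := s.exists_min_image f hs
  have hupper : ∑ i ∈ t \ s, f i ≤ (t \ s).card • f m :=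
    Finset.sum_le_card_nsmul _ _ _ fun j hj => htop m hm j (Finset.mem_sdiff.1 hj).2
  have hlower : (s \ t).card • f m ≤ ∑ i ∈ s \ t, f i :=
    Finset.card_nsmul_le_sum _ _ _ fun i hi => hmin i (Finset.mem_sdiff.1 hi).1
  rw [Finset.card_sdiff_comm hst] at hupper
  have hs_split := Finset.sum_inter_add_sum_sdiff s t f
  have ht_split := Finset.sum_inter_add_sum_sdiff t s f
  rw [Finset.inter_comm] at ht_split
  linarith

/-- Cauchy–Schwarz for a vector supported on `K`. -/
theorem dotProduct_le_sqrt_mul_sqrt_of_support {ι : Type*} [Fintype ι] {x : ι → ℝ}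
    (v : ι → ℝ) {K : Finset ι} (hx : ∀ i ∉ K, x i = 0) :
    x ⬝ᵥ v ≤ √(x ⬝ᵥ x) * √(∑ i ∈ K, v i ^ 2) := by
  have hsum (y : ι → ℝ) : x ⬝ᵥ y = ∑ i ∈ K, x i * y i :=
    (Finset.sum_subset (Finset.subset_univ K) fun i _ hi => by simp [hx i hi]).symm
  rw [hsum v, hsum x]
  simpa only [pow_two] using Real.sum_mul_le_sqrt_mul_sqrt K x v

/-- With `S = L * Lᵀ`, `L` invertible, `ŵ ≠ 0`, and `K*` a set of `k`
indices corresponding to `k` largest values of `|(Lᵀ ŵ)_i|`, the set `K*` minimizes,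
over all subsets `K` of cardinality `k`, the infimum over nonzero `w ∈ P_K` of the
angle between `Lᵀ w` and `Lᵀ ŵ`. -/
theorem topk_cholesky_selection_minimizes_angle {n : ℕ}
    (S L : Matrix (Fin n) (Fin n) ℝ) (hS : S.PosDef) (hL : IsUnit L)
    (hSL : S = L * Lᵀ) (what : Fin n → ℝ) (hwhat : what ≠ 0)
    (k : ℕ) (hk1 : 1 ≤ k) (hk2 : k ≤ n)
    (Kstar : Finset (Fin n)) (hcard : Kstar.card = k)
    (htop : ∀ i ∈ Kstar, ∀ j ∉ Kstar, |(Lᵀ *ᵥ what) j| ≤ |(Lᵀ *ᵥ what) i|) :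
    ∀ K : Finset (Fin n), K.card = k →
      sInf {θ : ℝ | ∃ w : Fin n → ℝ, w ≠ 0 ∧ (∀ i ∉ Kstar, (Lᵀ *ᵥ w) i = 0) ∧
          θ = Real.arccos ((Lᵀ *ᵥ w) ⬝ᵥ (Lᵀ *ᵥ what)
                / (Real.sqrt ((Lᵀ *ᵥ w) ⬝ᵥ (Lᵀ *ᵥ w)) *
                    Real.sqrt ((Lᵀ *ᵥ what) ⬝ᵥ (Lᵀ *ᵥ what))))}
        ≤ sInf {θ : ℝ | ∃ w : Fin n → ℝ, w ≠ 0 ∧ (∀ i ∉ K, (Lᵀ *ᵥ w) i = 0) ∧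
          θ = Real.arccos ((Lᵀ *ᵥ w) ⬝ᵥ (Lᵀ *ᵥ what)
                / (Real.sqrt ((Lᵀ *ᵥ w) ⬝ᵥ (Lᵀ *ᵥ w)) *
                    Real.sqrt ((Lᵀ *ᵥ what) ⬝ᵥ (Lᵀ *ᵥ what))))} := by
  intro K hK
  set v := Lᵀ *ᵥ what
  have hLT : IsUnit Lᵀ := (isUnit_transpose L).2 hL
  have hinj : Function.Injective (Lᵀ *ᵥ ·) := mulVec_injective_iff_isUnit.2 hLT
  have hsurj : Function.Surjective (Lᵀ *ᵥ ·) := mulVec_surjective_iff_isUnit.2 hLT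
  have hne {w : Fin n → ℝ} (hw : w ≠ 0) : Lᵀ *ᵥ w ≠ 0 := fun h =>
    hw (hinj (by simpa using h))
  have hv0 : v ≠ 0 := hne hwhat
  let u : Fin n → ℝ := fun i => if i ∈ Kstar then v i else 0
  have hu0 : u ≠ 0 := by
    intro hu
    have hvK : ∀ i ∈ Kstar, v i = 0 := fun i hi => by simpa [u, hi] using congrFun hu i
    obtain ⟨i, hi⟩ : Kstar.Nonempty := Finset.card_pos.1 (by omega)
    refine hv0 (funext fun j => ?_)
    by_cases hj : j ∈ Kstar
    · exact hvK j hj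
    · simpa [hvK i hi] using htop i hi j hj
  have huv : u ⬝ᵥ v = ∑ i ∈ Kstar, v i ^ 2 := by simp [dotProduct, u, ite_mul, pow_two]
  have huu : u ⬝ᵥ u = ∑ i ∈ Kstar, v i ^ 2 := by simp [dotProduct, u, pow_two]
  have hpos {x : Fin n → ℝ} (hx : x ≠ 0) : 0 < √(x ⬝ᵥ x) :=
    Real.sqrt_pos.2 (by simpa using dotProduct_star_self_pos_iff.2 hx)
  obtain ⟨wstar, hwstar⟩ := hsurj u
  dsimp only at hwstar
  apply le_csInf
  · obtain ⟨i, hi⟩ : K.Nonempty := Finset.card_pos.1 (by omega)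
    obtain ⟨w, hw⟩ := hsurj (Pi.single i 1)
    dsimp only at hw
    refine ⟨_, w, ?_, fun j hj => ?_, rfl⟩
    · rintro rfl
      simpa using congrFun hw i
    · rw [hw, Pi.single_eq_of_ne]
      rintro rfl
      exact hj hi
  rintro θ ⟨w, hw0, hwK, rfl⟩
  have hbdd : BddBelow {θ : ℝ | ∃ w : Fin n → ℝ, w ≠ 0 ∧ (∀ i ∉ Kstar, (Lᵀ *ᵥ w) i = 0) ∧
      θ = Real.arccos ((Lᵀ *ᵥ w) ⬝ᵥ v / (√((Lᵀ *ᵥ w) ⬝ᵥ (Lᵀ *ᵥ w)) * √(v ⬝ᵥ v)))} := by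
    refine ⟨0, ?_⟩
    rintro _ ⟨w, -, -, rfl⟩
    exact Real.arccos_nonneg _
  refine (csInf_le hbdd ⟨wstar, ?_, fun i hi => ?_, rfl⟩).trans (Real.arccos_le_arccos ?_)
  · rintro rfl
    exact hu0 (by simpa using hwstar.symm)
  · simp [hwstar, u, hi]
  have hmono : ∑ i ∈ K, v i ^ 2 ≤ u ⬝ᵥ u := huu ▸
    sum_le_sum_of_card_eq_of_top (hK.trans hcard.symm) fun i hi j hj => sq_le_sq.2 (htop i hi j hj)
  have hcs := (dotProduct_le_sqrt_mul_sqrt_of_support v hwK).trans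
    (mul_le_mul_of_nonneg_left (Real.sqrt_le_sqrt hmono) (Real.sqrt_nonneg _))
  rw [hwstar, ← div_div, ← div_div, huv.trans huu.symm, Real.div_sqrt]
  exact div_le_div_of_nonneg_right ((div_le_iff₀' (hpos (hne hw0))).2 hcs) (Real.sqrt_nonneg _)
end
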